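/- arXiv:1711.06674 — 8 statements merged into one kernel-verified Lean document; each statement's English description precedes it below -/
import Mathlib

section
/- Let m > 0 and let f be a test function. Define u(t) := (1/m)·∫_{-∞}^{t} sin(m·(t−s))·f(s) ds. Then u is smooth, u''(t) + m²·u(t) = f(t) for all t ∈ ℝ, and for every a ∈ ℝ, if f(s) = 0 for all s ≤ a then u(t) = 0 for all t ≤ a. (Existence of the retarded Green operator for the one-dimensional Klein–Gordon operator.) -/
open MeasureTheory

/-- The retarded propagator for the one-dimensional Klein–Gordon operator:
`(G^R f)(t) = (1/m) ∫_{-∞}^t sin(m (t - s)) f(s) ds`. -/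
noncomputable def retardedProp (m : ℝ) (f : ℝ → ℂ) (t : ℝ) : ℂ :=
  (1 / (m : ℂ)) * ∫ s in Set.Iic t, Complex.sin (((m * (t - s) : ℝ) : ℂ)) * f s

/-- The primitive based at `-∞` of a continuous compactly supported function. -/
theorem hasDerivAt_integral_Iic_of_hasCompactSupport {g : ℝ → ℂ} (hg : Continuous g)
    (hsupp : HasCompactSupport g) (t : ℝ) :
    HasDerivAt (fun x => ∫ s in Set.Iic x, g s) (g t) t := by
  have hint : Integrable g := hg.integrable_of_hasCompactSupport hsupp
  have heq : (fun x => ∫ s in Set.Iic x, g s) =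
      fun x => (∫ s in (0 : ℝ)..x, g s) + ∫ s in Set.Iic 0, g s := by
    funext x
    rw [← intervalIntegral.integral_Iic_sub_Iic hint.integrableOn hint.integrableOn]
    ring
  rw [heq]
  exact (hg.integral_hasStrictDerivAt 0 t).hasDerivAt.add_const _

theorem contDiff_integral_Iic_of_hasCompactSupport {g : ℝ → ℂ} (hg : ContDiff ℝ (⊤ : ℕ∞) g)
    (hsupp : HasCompactSupport g) :
    ContDiff ℝ (⊤ : ℕ∞) (fun x => ∫ s in Set.Iic x, g s) := by
  have hd := hasDerivAt_integral_Iic_of_hasCompactSupport hg.continuous hsupp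
  refine contDiff_infty_iff_deriv.2 ⟨fun t => (hd t).differentiableAt, ?_⟩
  rwa [show deriv (fun x => ∫ s in Set.Iic x, g s) = g from funext fun t => (hd t).deriv]

/-- Separation of variables in the retarded propagator by the addition formula for the sine. -/
theorem retardedProp_eq (m : ℝ) {f : ℝ → ℂ} (hf : Continuous f) (hsupp : HasCompactSupport f)
    (t : ℝ) :
    retardedProp m f t = (1 / (m : ℂ)) *
      (Complex.sin (m * t) * (∫ s in Set.Iic t, Complex.cos (m * s) * f s) -
        Complex.cos (m * t) * ∫ s in Set.Iic t, Complex.sin (m * s) * f s) := by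
  have hc : Integrable (fun s : ℝ => Complex.cos (m * s) * f s) :=
    Continuous.integrable_of_hasCompactSupport (by fun_prop) hsupp.mul_left
  have hs : Integrable (fun s : ℝ => Complex.sin (m * s) * f s) :=
    Continuous.integrable_of_hasCompactSupport (by fun_prop) hsupp.mul_left
  rw [retardedProp, ← integral_const_mul (Complex.sin _), ← integral_const_mul (Complex.cos _),
    ← integral_sub (hc.integrableOn.const_mul _) (hs.integrableOn.const_mul _)]
  congr 2
  funext s
  push_cast
  rw [mul_sub, Complex.sin_sub]
  ring

/-- For `m > 0` and a test function `f`, the function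
`u = G^R f` is smooth, satisfies `u'' + m² u = f`, and vanishes on `(-∞, a]`
whenever `f` vanishes on `(-∞, a]`. -/
theorem retarded_green_operator (m : ℝ) (hm : 0 < m)
    (f : ℝ → ℂ) (hf : ContDiff ℝ (⊤ : ℕ∞) f) (hsupp : HasCompactSupport f) :
    ContDiff ℝ (⊤ : ℕ∞) (retardedProp m f) ∧
    (∀ t : ℝ, deriv (deriv (retardedProp m f)) t + (m : ℂ) ^ 2 * retardedProp m f t = f t) ∧
    (∀ a : ℝ, (∀ s ≤ a, f s = 0) → ∀ t ≤ a, retardedProp m f t = 0) := by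
  have hofReal : ContDiff ℝ (⊤ : ℕ∞) (fun t : ℝ => (t : ℂ)) := Complex.ofRealCLM.contDiff
  have hlin : ContDiff ℝ (⊤ : ℕ∞) (fun t : ℝ => (m : ℂ) * t) := contDiff_const.mul hofReal
  have hsin : ContDiff ℝ (⊤ : ℕ∞) (fun t : ℝ => Complex.sin (m * t)) :=
    (Complex.contDiff_sin.restrict_scalars ℝ).comp hlin
  have hcos : ContDiff ℝ (⊤ : ℕ∞) (fun t : ℝ => Complex.cos (m * t)) :=
    (Complex.contDiff_cos.restrict_scalars ℝ).comp hlin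
  have hm0 : (m : ℂ) ≠ 0 := by exact_mod_cast hm.ne'
  have hu : retardedProp m f = _ := funext (retardedProp_eq m hf.continuous hsupp)
  have hCs := contDiff_integral_Iic_of_hasCompactSupport (hcos.mul hf) hsupp.mul_left
  have hSs := contDiff_integral_Iic_of_hasCompactSupport (hsin.mul hf) hsupp.mul_left
  have hC := hasDerivAt_integral_Iic_of_hasCompactSupport (hcos.mul hf).continuous
    hsupp.mul_left
  have hS := hasDerivAt_integral_Iic_of_hasCompactSupport (hsin.mul hf).continuous
    hsupp.mul_left
  refine ⟨?_, fun t => ?_, fun a ha t hta => ?_⟩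
  · rw [hu]
    exact contDiff_const.mul ((hsin.mul hCs).sub (hcos.mul hSs))
  · have hlind (x : ℝ) : HasDerivAt (fun t : ℝ => (m : ℂ) * t) m x := by
      simpa using (Complex.ofRealCLM.hasDerivAt (x := x)).const_mul (m : ℂ)
    have hsind (x : ℝ) := (Complex.hasDerivAt_sin (m * x)).comp x (hlind x)
    have hcosd (x : ℝ) := (Complex.hasDerivAt_cos (m * x)).comp x (hlind x)
    have hd : deriv (retardedProp m f) = fun x : ℝ =>
        Complex.cos (m * x) * (∫ s in Set.Iic x, Complex.cos (m * s) * f s) +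
          Complex.sin (m * x) * ∫ s in Set.Iic x, Complex.sin (m * s) * f s := by
      funext x
      rw [hu]
      refine ((((hsind x).mul (hC x)).sub ((hcosd x).mul (hS x))).const_mul
        (1 / (m : ℂ))).deriv.trans ?_
      simp only [Function.comp_apply]
      field_simp
      ring
    have hdd := (((hcosd t).mul (hC t)).add ((hsind t).mul (hS t))).deriv
    rw [hd, hu]
    refine (congrArg (· + _) hdd).trans ?_
    simp only [Function.comp_apply]
    field_simp
    linear_combination f t * Complex.sin_sq_add_cos_sq (m * t)
  · rw [retardedProp, setIntegral_eq_zero_of_forall_eq_zero, mul_zero]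
    intro s hs
    rw [ha s (le_trans hs hta), mul_zero]
end

section
/- Let m > 0. Define the Peierls pairing on test functions by σ(f, g) := ∫_ℝ f(t)·(G^C g)(t) dt. Then σ is antisymmetric, i.e. σ(f, g) = −σ(g, f) for all test functions f, g; moreover, for a test function f one has σ(f, g) = 0 for every test function g if and only if there exists a test function h with f = h'' + m²·h. (The radical of the Peierls bracket pairing for the one-dimensional free scalar field is exactly the image of the Klein–Gordon operator on test functions.) -/
open MeasureTheory

/-- The causal propagator `(G^C f)(t) = (1/m) ∫_ℝ sin(m (t - s)) f(s) ds`. -/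
noncomputable def causalProp (m : ℝ) (f : ℝ → ℂ) (t : ℝ) : ℂ :=
  (1 / (m : ℂ)) * ∫ s : ℝ, Complex.sin (((m * (t - s) : ℝ) : ℂ)) * f s

/-- A test function: smooth with compact support. -/
def IsTestFunction (f : ℝ → ℂ) : Prop := ContDiff ℝ (⊤ : ℕ∞) f ∧ HasCompactSupport f

/-- The Peierls pairing `σ(f, g) = ∫ f (G^C g)`. -/
noncomputable def peierlsPairing (m : ℝ) (f g : ℝ → ℂ) : ℂ :=
  ∫ t : ℝ, f t * causalProp m g t

lemma contDiff_cos_mul (m : ℝ) :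
    ContDiff ℝ (⊤ : ℕ∞) fun t : ℝ => Complex.cos ((m : ℂ) * (t : ℂ)) := by
  have h : ContDiff ℝ (⊤ : ℕ∞) fun t : ℝ => (t : ℂ) := Complex.ofRealCLM.contDiff
  have hc : ContDiff ℝ (⊤ : ℕ∞) Complex.cos := Complex.contDiff_cos.restrict_scalars ℝ
  exact hc.comp (contDiff_const.mul h)

lemma contDiff_sin_mul (m : ℝ) :
    ContDiff ℝ (⊤ : ℕ∞) fun t : ℝ => Complex.sin ((m : ℂ) * (t : ℂ)) := by
  have h : ContDiff ℝ (⊤ : ℕ∞) fun t : ℝ => (t : ℂ) := Complex.ofRealCLM.contDiff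
  have hs : ContDiff ℝ (⊤ : ℕ∞) Complex.sin := Complex.contDiff_sin.restrict_scalars ℝ
  exact hs.comp (contDiff_const.mul h)

lemma hasDerivAt_sin_mul (m t : ℝ) :
    HasDerivAt (fun t : ℝ => Complex.sin ((m : ℂ) * (t : ℂ)))
      (m * Complex.cos ((m : ℂ) * (t : ℂ))) t := by
  have h := ((Complex.hasDerivAt_sin _).comp (t : ℂ)
    ((hasDerivAt_id (t : ℂ)).const_mul (m : ℂ))).comp_ofReal
  exact h.congr_deriv (by simp only [id]; ring)

lemma hasDerivAt_cos_mul (m t : ℝ) :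
    HasDerivAt (fun t : ℝ => Complex.cos ((m : ℂ) * (t : ℂ)))
      (-(m * Complex.sin ((m : ℂ) * (t : ℂ)))) t := by
  have h := ((Complex.hasDerivAt_cos _).comp (t : ℂ)
    ((hasDerivAt_id (t : ℂ)).const_mul (m : ℂ))).comp_ofReal
  exact h.congr_deriv (by simp only [id]; ring)

namespace IsTestFunction

variable {f g w : ℝ → ℂ}

lemma integrable (hf : IsTestFunction f) : Integrable f :=
  hf.1.continuous.integrable_of_hasCompactSupport hf.2

lemma mul_left (hf : IsTestFunction f) (hw : ContDiff ℝ (⊤ : ℕ∞) w) :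
    IsTestFunction fun t => w t * f t :=
  ⟨hw.mul hf.1, hf.2.mul_left⟩

lemma add (hf : IsTestFunction f) (hg : IsTestFunction g) :
    IsTestFunction fun t => f t + g t :=
  ⟨hf.1.add hg.1, hf.2.add hg.2⟩

lemma sub (hf : IsTestFunction f) (hg : IsTestFunction g) :
    IsTestFunction fun t => f t - g t :=
  ⟨hf.1.sub hg.1, hf.2.sub hg.2⟩

lemma deriv (hf : IsTestFunction f) : IsTestFunction (deriv f) :=
  ⟨(contDiff_infty_iff_deriv.1 hf.1).2, hf.2.deriv⟩

lemma hasDerivAt (hf : IsTestFunction f) (t : ℝ) : HasDerivAt f (_root_.deriv f t) t :=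
  ((contDiff_infty_iff_deriv.1 hf.1).1 t).hasDerivAt

/-- A test function with vanishing integral is the derivative of a test function. -/
lemma exists_primitive (hf : IsTestFunction f) (h0 : ∫ t, f t = 0) :
    ∃ F : ℝ → ℂ, IsTestFunction F ∧ ∀ t, HasDerivAt F (f t) t := by
  obtain ⟨R, hR⟩ := hf.2.isCompact.isBounded.subset_closedBall 0
  have hsupp : ∀ t, t ∉ Set.Icc (-R) R → f t = 0 := fun t ht => by
    refine image_eq_zero_of_notMem_tsupport fun h => ht ?_
    simpa [Real.closedBall_eq_Icc] using hR h
  have hF : ∀ t, HasDerivAt (fun t => ∫ s in Set.Iic t, f s) (f t) t := fun t => by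
    have h := (intervalIntegral.integral_hasDerivAt_right
      (hf.integrable.intervalIntegrable (a := 0) (b := t))
      hf.1.continuous.stronglyMeasurable.stronglyMeasurableAtFilter
      hf.1.continuous.continuousAt).add_const (∫ s in Set.Iic (0 : ℝ), f s)
    refine h.congr_of_eventuallyEq (Filter.Eventually.of_forall fun x => ?_)
    simp [← intervalIntegral.integral_Iic_sub_Iic (hf.integrable.integrableOn (s := Set.Iic 0))
      (hf.integrable.integrableOn (s := Set.Iic x))]
  refine ⟨_, ⟨contDiff_infty_iff_deriv.2 ⟨fun t => (hF t).differentiableAt, ?_⟩, ?_⟩, hF⟩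
  · rw [show _root_.deriv (fun t => ∫ s in Set.Iic t, f s) = f from funext fun t => (hF t).deriv]
    exact hf.1
  · refine HasCompactSupport.intro (isCompact_Icc (a := -R) (b := R)) fun t ht => ?_
    rcases lt_or_ge t (-R) with h | h
    · refine setIntegral_eq_zero_of_forall_eq_zero fun s hs => hsupp s fun h' => ?_
      exact absurd (h'.1.trans hs) (not_le.2 h)
    · have h2 : R < t := by
        by_contra! h2
        exact ht ⟨h, h2⟩
      rw [setIntegral_eq_integral_of_forall_compl_eq_zero, h0]
      intro s hs
      exact hsupp s fun h' => hs (h'.2.trans h2.le)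

end IsTestFunction

lemma causalProp_eq (m : ℝ) {f : ℝ → ℂ} (hf : IsTestFunction f) (t : ℝ) :
    causalProp m f t = (1 / (m : ℂ)) *
      (Complex.sin ((m : ℂ) * t) * (∫ s : ℝ, Complex.cos ((m : ℂ) * s) * f s) -
        Complex.cos ((m : ℂ) * t) * ∫ s : ℝ, Complex.sin ((m : ℂ) * s) * f s) := by
  rw [causalProp, ← integral_const_mul (Complex.sin (m * t)),
    ← integral_const_mul (Complex.cos (m * t)), ← integral_sub
    ((hf.mul_left (contDiff_cos_mul m)).integrable.const_mul _)
    ((hf.mul_left (contDiff_sin_mul m)).integrable.const_mul _)]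
  congr 2
  ext s
  push_cast
  rw [mul_sub, Complex.sin_sub]
  ring

lemma peierlsPairing_eq (m : ℝ) {f g : ℝ → ℂ} (hf : IsTestFunction f) (hg : IsTestFunction g) :
    peierlsPairing m f g = (1 / (m : ℂ)) *
      ((∫ s : ℝ, Complex.sin ((m : ℂ) * s) * f s) * (∫ s : ℝ, Complex.cos ((m : ℂ) * s) * g s) -
        (∫ s : ℝ, Complex.cos ((m : ℂ) * s) * f s) *
          ∫ s : ℝ, Complex.sin ((m : ℂ) * s) * g s) := by
  rw [peierlsPairing, ← integral_mul_const, ← integral_mul_const, ← integral_sub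
    ((hf.mul_left (contDiff_sin_mul m)).integrable.mul_const _)
    ((hf.mul_left (contDiff_cos_mul m)).integrable.mul_const _), ← integral_const_mul]
  congr 1
  ext t
  rw [causalProp_eq m hg]
  ring

lemma peierlsPairing_antisymm (m : ℝ) {f g : ℝ → ℂ} (hf : IsTestFunction f)
    (hg : IsTestFunction g) : peierlsPairing m f g = -peierlsPairing m g f := by
  rw [peierlsPairing_eq m hf hg, peierlsPairing_eq m hg hf]
  ring

lemma causalProp_eq_zero_of_forall_peierlsPairing_eq_zero (m : ℝ) {f : ℝ → ℂ}
    (hf : IsTestFunction f) (h : ∀ g : ℝ → ℂ, IsTestFunction g → peierlsPairing m f g = 0) :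
    causalProp m f = 0 := by
  have hc : Continuous (causalProp m f) := by
    rw [funext (causalProp_eq m hf)]
    exact continuous_const.mul (((contDiff_sin_mul m).continuous.mul continuous_const).sub
      ((contDiff_cos_mul m).continuous.mul continuous_const))
  refine (hc.ae_eq_iff_eq volume continuous_const).1 ?_
  refine ae_eq_zero_of_integral_contDiff_smul_eq_zero hc.locallyIntegrable fun g hg hgc => ?_
  have hg' : IsTestFunction fun t => (g t : ℂ) :=
    ⟨Complex.ofRealCLM.contDiff.comp hg, hgc.comp_left Complex.ofReal_zero⟩
  have h0 := peierlsPairing_antisymm m hg' hf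
  rw [h _ hg', neg_zero] at h0
  simpa [peierlsPairing, Complex.real_smul] using h0

/-- The two Fourier moments at frequency `m` of an element of the radical vanish. -/
lemma moments_eq_zero_of_causalProp_eq_zero {m : ℝ} (hm : 0 < m) {f : ℝ → ℂ}
    (hf : IsTestFunction f) (h : causalProp m f = 0) :
    (∫ s : ℝ, Complex.cos ((m : ℂ) * s) * f s) = 0 ∧
      (∫ s : ℝ, Complex.sin ((m : ℂ) * s) * f s) = 0 := by
  have hm' : (m : ℂ) ≠ 0 := by exact_mod_cast hm.ne'
  have h0 := congrFun h 0
  have h1 := congrFun h (Real.pi / 2 / m)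
  rw [causalProp_eq m hf] at h0 h1
  have e : (m : ℂ) * ((Real.pi / 2 / m : ℝ) : ℂ) = (Real.pi : ℂ) / 2 := by
    push_cast
    field_simp
  rw [e] at h1
  constructor
  · simpa [hm'] using h1
  · simpa [hm'] using h0

/-- Test functions whose moments against `cos (m t)` and `sin (m t)` vanish are in the image of
the Klein–Gordon operator. -/
lemma exists_kleinGordon_eq {m : ℝ} (hm : m ≠ 0) {f : ℝ → ℂ} (hf : IsTestFunction f)
    (hcos : (∫ s : ℝ, Complex.cos ((m : ℂ) * s) * f s) = 0)
    (hsin : (∫ s : ℝ, Complex.sin ((m : ℂ) * s) * f s) = 0) :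
    ∃ h : ℝ → ℂ, IsTestFunction h ∧ f = fun t => deriv (deriv h) t + (m : ℂ) ^ 2 * h t := by
  have hm' : (m : ℂ) ≠ 0 := by exact_mod_cast hm
  obtain ⟨A, hA, hA'⟩ := (hf.mul_left (contDiff_cos_mul m)).exists_primitive hcos
  obtain ⟨B, hB, hB'⟩ := (hf.mul_left (contDiff_sin_mul m)).exists_primitive hsin
  let h : ℝ → ℂ := fun t => (1 / (m : ℂ)) *
    (Complex.sin ((m : ℂ) * t) * A t - Complex.cos ((m : ℂ) * t) * B t)
  have h1 : deriv h = fun t : ℝ =>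
      Complex.cos ((m : ℂ) * t) * A t + Complex.sin ((m : ℂ) * t) * B t := by
    ext t
    refine HasDerivAt.deriv ?_
    refine ((((hasDerivAt_sin_mul m t).mul (hA' t)).sub
      ((hasDerivAt_cos_mul m t).mul (hB' t))).const_mul (1 / (m : ℂ))).congr_deriv ?_
    field_simp
    ring
  refine ⟨h, ((hA.mul_left (contDiff_sin_mul m)).sub
    (hB.mul_left (contDiff_cos_mul m))).mul_left contDiff_const, ?_⟩
  ext t
  have h2 := ((hasDerivAt_cos_mul m t).mul (hA' t)).add ((hasDerivAt_sin_mul m t).mul (hB' t))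
  rw [h1, show deriv (fun t : ℝ => Complex.cos ((m : ℂ) * t) * A t +
    Complex.sin ((m : ℂ) * t) * B t) t = _ from h2.deriv]
  simp only [h]
  field_simp
  linear_combination (-f t) * Complex.sin_sq_add_cos_sq ((m : ℂ) * t)

/-- A solution `w` of the Klein–Gordon equation annihilates the image of test functions. -/
lemma integral_mul_kleinGordon_eq_zero {m : ℝ} {w w' h : ℝ → ℂ} (hw : ContDiff ℝ (⊤ : ℕ∞) w)
    (hw' : ContDiff ℝ (⊤ : ℕ∞) w') (hd : ∀ t, HasDerivAt w (w' t) t)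
    (hd' : ∀ t, HasDerivAt w' (-((m : ℂ) ^ 2 * w t)) t) (hh : IsTestFunction h) :
    ∫ t, w t * (deriv (deriv h) t + (m : ℂ) ^ 2 * h t) = 0 := by
  refine integral_eq_zero_of_hasDerivAt_of_integrable
    (f := fun t => w t * deriv h t - w' t * h t) (fun t => ?_)
    ((hh.deriv.deriv.add (hh.mul_left contDiff_const)).mul_left hw).integrable
    ((hh.deriv.mul_left hw).sub (hh.mul_left hw')).integrable
  refine (((hd t).mul (hh.deriv.hasDerivAt t)).sub
    ((hd' t).mul (hh.hasDerivAt t))).congr_deriv ?_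
  ring


/-- The Peierls pairing `σ(f,g) = ∫ f · G^C g` is antisymmetric on
test functions, and its radical is exactly the image of the Klein–Gordon
operator on test functions. -/
theorem peierls_pairing_antisymm_and_radical (m : ℝ) (hm : 0 < m) :
    (∀ f g : ℝ → ℂ, IsTestFunction f → IsTestFunction g →
      peierlsPairing m f g = -peierlsPairing m g f) ∧
    (∀ f : ℝ → ℂ, IsTestFunction f →
      ((∀ g : ℝ → ℂ, IsTestFunction g → peierlsPairing m f g = 0) ↔
        (∃ h : ℝ → ℂ, IsTestFunction h ∧
          f = fun t => deriv (deriv h) t + (m : ℂ) ^ 2 * h t))) := by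
  refine ⟨fun f g hf hg => peierlsPairing_antisymm m hf hg, fun f hf => ⟨fun h => ?_, ?_⟩⟩
  · obtain ⟨hcos, hsin⟩ := moments_eq_zero_of_causalProp_eq_zero hm hf
      (causalProp_eq_zero_of_forall_peierlsPairing_eq_zero m hf h)
    exact exists_kleinGordon_eq hm.ne' hf hcos hsin
  · rintro ⟨h, hh, rfl⟩ g hg
    have hcos := integral_mul_kleinGordon_eq_zero (m := m) (contDiff_cos_mul m)
      (contDiff_const.mul (contDiff_sin_mul m)).neg (hasDerivAt_cos_mul m)
      (fun t => (((hasDerivAt_sin_mul m t).const_mul (m : ℂ)).neg).congr_deriv (by ring)) hh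
    have hsin := integral_mul_kleinGordon_eq_zero (m := m) (contDiff_sin_mul m)
      (contDiff_const.mul (contDiff_cos_mul m)) (hasDerivAt_sin_mul m)
      (fun t => ((hasDerivAt_cos_mul m t).const_mul (m : ℂ)).congr_deriv (by ring)) hh
    rw [peierlsPairing_eq m hf hg, hcos, hsin]
    simp
end

section
/- Let m > 0. For every smooth function u : ℝ → ℂ satisfying u''(t) + m²·u(t) = 0 for all t, there exists a test function f such that u(t) = (G^C f)(t) for all t ∈ ℝ. (Exactness of the hyperbolic sequence at the third slot in one dimension: every smooth solution of the Klein–Gordon equation lies in the image of the causal propagator.) -/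
open MeasureTheory

/-- For fixed `t`, the Wronskian in `s` of `v` against the kernel `sin (m (t - s))`. -/
noncomputable def kernelWronskian (m t : ℝ) (v : ℝ → ℂ) (s : ℝ) : ℂ :=
  Complex.sin ((m * (t - s) : ℝ) : ℂ) * deriv v s +
    m * Complex.cos ((m * (t - s) : ℝ) : ℂ) * v s

theorem hasDerivAt_kernelWronskian (m t : ℝ) {v : ℝ → ℂ} (hv : ContDiff ℝ (⊤ : ℕ∞) v) (s : ℝ) :
    HasDerivAt (kernelWronskian m t v)
      (Complex.sin ((m * (t - s) : ℝ) : ℂ) * (deriv (deriv v) s + (m : ℂ) ^ 2 * v s)) s := by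
  have hv' : ContDiff ℝ (⊤ : ℕ∞) (deriv v) := (contDiff_infty_iff_deriv.1 hv).2
  have hdv := (hv.differentiable (by simp) s).hasDerivAt
  have hddv := (hv'.differentiable (by simp) s).hasDerivAt
  have hphase : HasDerivAt (fun s : ℝ => ((m * (t - s) : ℝ) : ℂ)) (-(m : ℂ)) s := by
    simpa using (((hasDerivAt_id s).const_sub t).const_mul m).ofReal_comp
  have hsin := (Complex.hasDerivAt_sin ((m * (t - s) : ℝ) : ℂ)).comp s hphase
  have hcos := (Complex.hasDerivAt_cos ((m * (t - s) : ℝ) : ℂ)).comp s hphase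
  refine ((hsin.mul hddv).add ((hcos.const_mul (m : ℂ)).mul hdv)).congr_deriv ?_
  simp only [Function.comp_apply]
  ring

theorem kernelWronskian_congr (m t : ℝ) {v w : ℝ → ℂ} {s : ℝ} (h : v =ᶠ[nhds s] w) :
    kernelWronskian m t v s = kernelWronskian m t w s := by
  simp only [kernelWronskian, h.deriv_eq, h.eq_of_nhds]

theorem kernelWronskian_eq_of_solution (m t : ℝ) {u : ℝ → ℂ} (hu : ContDiff ℝ (⊤ : ℕ∞) u)
    (hsol : ∀ t : ℝ, deriv (deriv u) t + (m : ℂ) ^ 2 * u t = 0) (s : ℝ) :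
    kernelWronskian m t u s = m * u t := by
  have hderiv (r : ℝ) : HasDerivAt (kernelWronskian m t u) 0 r := by
    simpa only [hsol, mul_zero] using hasDerivAt_kernelWronskian m t hu r
  rw [is_const_of_deriv_eq_zero (fun r => (hderiv r).differentiableAt)
    (fun r => (hderiv r).deriv) s t]
  simp [kernelWronskian]

/-- Every smooth solution of the one-dimensional Klein–Gordon
equation is in the image of the causal propagator applied to test functions. -/
theorem solution_in_image_of_causal_prop (m : ℝ) (hm : 0 < m)
    (u : ℝ → ℂ) (hu : ContDiff ℝ (⊤ : ℕ∞) u)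
    (hsol : ∀ t : ℝ, deriv (deriv u) t + (m : ℂ) ^ 2 * u t = 0) :
    ∃ f : ℝ → ℂ, ContDiff ℝ (⊤ : ℕ∞) f ∧ HasCompactSupport f ∧
      ∀ t : ℝ, u t = causalProp m f t := by
  let v : ℝ → ℂ := fun s => (Real.smoothTransition s : ℂ) * u s
  have hv : ContDiff ℝ (⊤ : ℕ∞) v :=
    (Complex.ofRealCLM.contDiff.comp Real.smoothTransition.contDiff).mul hu
  have hv_left {s : ℝ} (hs : s < 0) : v =ᶠ[nhds s] fun _ => 0 := by
    filter_upwards [Iio_mem_nhds hs] with r hr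
    simp [v, Real.smoothTransition.zero_of_nonpos (le_of_lt hr)]
  have hv_right {s : ℝ} (hs : 1 < s) : v =ᶠ[nhds s] u := by
    filter_upwards [Ioi_mem_nhds hs] with r hr
    simp [v, Real.smoothTransition.one_of_one_le (le_of_lt hr)]
  let f : ℝ → ℂ := fun s => deriv (deriv v) s + (m : ℂ) ^ 2 * v s
  have hf : ContDiff ℝ (⊤ : ℕ∞) f :=
    (contDiff_infty_iff_deriv.1 (contDiff_infty_iff_deriv.1 hv).2).2.add (contDiff_const.mul hv)
  have hf_zero (s : ℝ) (hs : s ∉ Set.Icc (0 : ℝ) 1) : f s = 0 := by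
    rcases lt_or_ge s 0 with h | h
    · simp [f, (hv_left h).deriv.deriv_eq, (hv_left h).eq_of_nhds]
    · have h1 : 1 < s := lt_of_not_ge fun h1 => hs ⟨h, h1⟩
      simp only [f, (hv_right h1).deriv.deriv_eq, (hv_right h1).eq_of_nhds, hsol]
  refine ⟨f, hf, HasCompactSupport.intro isCompact_Icc hf_zero, fun t => ?_⟩
  have hsupp : Function.support (fun s : ℝ => Complex.sin ((m * (t - s) : ℝ) : ℂ) * f s) ⊆
      Set.Ioc (-1) 2 := by
    intro s hs
    have h : s ∈ Set.Icc (0 : ℝ) 1 := by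
      by_contra h
      exact hs (by simp [hf_zero s h])
    exact ⟨by linarith [h.1], by linarith [h.2]⟩
  have hcont : Continuous (fun s : ℝ => Complex.sin ((m * (t - s) : ℝ) : ℂ) * f s) := by
    have := hf.continuous
    fun_prop
  have hleft : kernelWronskian m t v (-1) = 0 := by
    rw [kernelWronskian_congr m t (hv_left (by norm_num))]
    simp [kernelWronskian]
  have hm' : (m : ℂ) ≠ 0 := by exact_mod_cast hm.ne'
  rw [causalProp, ← intervalIntegral.integral_eq_integral_of_support_subset hsupp,
    intervalIntegral.integral_eq_sub_of_hasDerivAt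
      (fun s _ => hasDerivAt_kernelWronskian m t hv s) (hcont.intervalIntegrable _ _),
    hleft, kernelWronskian_congr m t (hv_right (by norm_num)),
    kernelWronskian_eq_of_solution m t hu hsol]
  field_simp
  simp
end

section
/- Let m > 0, let f be a test function, and set u := G^R f. Let c ≤ d be real numbers with f(t) = 0 for all t ≥ d, let χ : ℝ → ℝ be a smooth function with χ(t) = 1 for all t ≤ c and χ(t) = 0 for all t ≥ d, and set g := f − ((χ·u)'' + m²·(χ·u)). Then for every smooth function φ : ℝ → ℂ with φ'' + m²·φ = 0 one has ∫_ℝ g(t)·φ(t) dt = ∫_ℝ f(t)·φ(t) dt. (The replaced observable of the time-slice construction agrees with the original one on all solutions, i.e. they differ by an element of the ideal generated by the equations of motion.) -/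
open MeasureTheory

/-- The primitive `t ↦ ∫_{-∞}^t h` of a smooth integrable function is smooth. -/
theorem contDiff_integral_Iic {h : ℝ → ℂ} (hh : ContDiff ℝ (⊤ : ℕ∞) h) (hi : Integrable h) :
    ContDiff ℝ (⊤ : ℕ∞) fun t => ∫ s in Set.Iic t, h s := by
  have hd : ∀ t, HasDerivAt (fun t => ∫ s in Set.Iic t, h s) (h t) t := by
    intro t
    have heq : (fun t => ∫ s in Set.Iic t, h s) =
        fun t => (∫ s in Set.Iic (0 : ℝ), h s) + ∫ s in (0 : ℝ)..t, h s := by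
      funext t
      rw [← intervalIntegral.integral_Iic_sub_Iic hi.integrableOn hi.integrableOn]
      ring
    rw [heq]
    exact (intervalIntegral.integral_hasDerivAt_right hi.intervalIntegrable
      (hh.continuous.stronglyMeasurableAtFilter _ _) hh.continuous.continuousAt).const_add _
  rw [contDiff_infty_iff_deriv]
  refine ⟨fun t => (hd t).differentiableAt, ?_⟩
  rwa [funext fun t => (hd t).deriv]

theorem contDiff_retardedProp (m : ℝ) {f : ℝ → ℂ} (hf : ContDiff ℝ (⊤ : ℕ∞) f)
    (hfsupp : HasCompactSupport f) : ContDiff ℝ (⊤ : ℕ∞) (retardedProp m f) := by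
  have hlin : ContDiff ℝ (⊤ : ℕ∞) fun s : ℝ => (m : ℂ) * (s : ℂ) :=
    contDiff_const.mul Complex.ofRealCLM.contDiff
  have hcos : ContDiff ℝ (⊤ : ℕ∞) fun s : ℝ => Complex.cos ((m : ℂ) * (s : ℂ)) :=
    Complex.contDiff_cos.restrict_scalars ℝ |>.comp hlin
  have hsin : ContDiff ℝ (⊤ : ℕ∞) fun s : ℝ => Complex.sin ((m : ℂ) * (s : ℂ)) :=
    Complex.contDiff_sin.restrict_scalars ℝ |>.comp hlin
  have hic : Integrable fun s : ℝ => Complex.cos ((m : ℂ) * (s : ℂ)) * f s :=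
    (hcos.mul hf).continuous.integrable_of_hasCompactSupport hfsupp.mul_left
  have his : Integrable fun s : ℝ => Complex.sin ((m : ℂ) * (s : ℂ)) * f s :=
    (hsin.mul hf).continuous.integrable_of_hasCompactSupport hfsupp.mul_left
  have heq : retardedProp m f = fun t : ℝ => (1 / (m : ℂ)) *
      (Complex.sin (m * t) * (∫ s in Set.Iic t, Complex.cos ((m : ℂ) * (s : ℂ)) * f s) -
        Complex.cos (m * t) * ∫ s in Set.Iic t, Complex.sin ((m : ℂ) * (s : ℂ)) * f s) := by
    funext t
    rw [retardedProp, ← integral_const_mul (Complex.sin (m * t)),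
      ← integral_const_mul (Complex.cos (m * t)),
      ← integral_sub (hic.integrableOn.const_mul _) (his.integrableOn.const_mul _)]
    congr 2
    funext s
    push_cast
    rw [mul_sub, Complex.sin_sub]
    ring
  rw [heq]
  exact contDiff_const.mul ((hsin.mul (contDiff_integral_Iic (hcos.mul hf) hic)).sub
    (hcos.mul (contDiff_integral_Iic (hsin.mul hf) his)))

theorem retardedProp_eq_zero_of_le (m : ℝ) {f : ℝ → ℂ} {t : ℝ} (h : ∀ s ≤ t, f s = 0) :
    retardedProp m f t = 0 := by
  rw [retardedProp, setIntegral_eq_zero_of_forall_eq_zero, mul_zero]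
  intro s hs
  rw [h s hs, mul_zero]

/-- Multiplying the retarded solution by a function vanishing in the future gives a compactly
supported function. -/
theorem hasCompactSupport_mul_retardedProp (m : ℝ) {f : ℝ → ℂ} (hfsupp : HasCompactSupport f)
    {d : ℝ} {ψ : ℝ → ℂ} (hψ : ∀ t, d ≤ t → ψ t = 0) :
    HasCompactSupport fun t => ψ t * retardedProp m f t := by
  obtain ⟨a, ha⟩ := hfsupp.isCompact.bddBelow
  refine HasCompactSupport.intro (isCompact_Icc (a := a) (b := d)) fun t ht => ?_
  rcases lt_or_ge t a with hta | hta
  · rw [retardedProp_eq_zero_of_le, mul_zero]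
    intro s hs
    by_contra hne
    exact absurd (ha (subset_tsupport f hne)) (not_le.mpr (hs.trans_lt hta))
  · rw [hψ t (not_lt.mp fun htd => ht ⟨hta, htd.le⟩), zero_mul]

/-- Second-order integration by parts against a compactly supported function. -/
theorem integral_deriv_deriv_mul {w φ : ℝ → ℂ} (hw : ContDiff ℝ (⊤ : ℕ∞) w)
    (hwsupp : HasCompactSupport w) (hφ : ContDiff ℝ (⊤ : ℕ∞) φ) :
    ∫ t, deriv (deriv w) t * φ t = ∫ t, w t * deriv (deriv φ) t := by
  have hw1 := (contDiff_infty_iff_deriv.mp hw).2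
  have hw2 := (contDiff_infty_iff_deriv.mp hw1).2
  have hφ1 := (contDiff_infty_iff_deriv.mp hφ).2
  have hφ2 := (contDiff_infty_iff_deriv.mp hφ1).2
  have key : ∀ {v ψ : ℝ → ℂ}, ContDiff ℝ (⊤ : ℕ∞) v → HasCompactSupport v →
      ContDiff ℝ (⊤ : ℕ∞) ψ → Integrable (v * ψ) := fun hv hc hψ =>
    (hv.mul hψ).continuous.integrable_of_hasCompactSupport hc.mul_right
  have hdiff : ∀ {v : ℝ → ℂ}, ContDiff ℝ (⊤ : ℕ∞) v → ∀ t, HasDerivAt v (deriv v t) t :=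
    fun hv t => ((contDiff_infty_iff_deriv.mp hv).1 t).hasDerivAt
  rw [integral_mul_deriv_eq_deriv_mul_of_integrable (fun t _ => hdiff hw t)
      (fun t _ => hdiff hφ1 t) (key hw hwsupp hφ2) (key hw1 hwsupp.deriv hφ1)
      (key hw hwsupp hφ1),
    integral_mul_deriv_eq_deriv_mul_of_integrable (fun t _ => hdiff hw1 t)
      (fun t _ => hdiff hφ t) (key hw1 hwsupp.deriv hφ1) (key hw2 hwsupp.deriv.deriv hφ)
      (key hw1 hwsupp.deriv hφ), neg_neg]

/-- The time-slice construction: with `u = G^R f` and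
`g = f - P(χ · u)`, the observables `O_g` and `O_f` agree on every smooth
solution `φ` of the Klein–Gordon equation. -/
theorem time_slice_agrees_on_solutions (m : ℝ) (hm : 0 < m)
    (f : ℝ → ℂ) (hf : ContDiff ℝ (⊤ : ℕ∞) f) (hfsupp : HasCompactSupport f)
    (c d : ℝ) (hcd : c ≤ d) (hfd : ∀ t : ℝ, d ≤ t → f t = 0)
    (χ : ℝ → ℝ) (hχ : ContDiff ℝ (⊤ : ℕ∞) χ)
    (hχ1 : ∀ t : ℝ, t ≤ c → χ t = 1) (hχ0 : ∀ t : ℝ, d ≤ t → χ t = 0) :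
    letI u : ℝ → ℂ := retardedProp m f
    letI g : ℝ → ℂ := fun t =>
      f t - (deriv (deriv (fun s : ℝ => (χ s : ℂ) * u s)) t
              + (m : ℂ) ^ 2 * ((χ t : ℂ) * u t))
    ∀ φ : ℝ → ℂ, ContDiff ℝ (⊤ : ℕ∞) φ →
      (∀ t : ℝ, deriv (deriv φ) t + (m : ℂ) ^ 2 * φ t = 0) →
      ∫ t : ℝ, g t * φ t = ∫ t : ℝ, f t * φ t := by
  intro φ hφ hφeq
  set w : ℝ → ℂ := fun s => (χ s : ℂ) * retardedProp m f s
  have hw : ContDiff ℝ (⊤ : ℕ∞) w :=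
    (Complex.ofRealCLM.contDiff.comp hχ).mul (contDiff_retardedProp m hf hfsupp)
  have hwsupp : HasCompactSupport w :=
    hasCompactSupport_mul_retardedProp m hfsupp fun t ht => by rw [hχ0 t ht, Complex.ofReal_zero]
  have hw2 := (contDiff_infty_iff_deriv.mp (contDiff_infty_iff_deriv.mp hw).2).2
  have hi0 : Integrable fun t => f t * φ t :=
    (hf.mul hφ).continuous.integrable_of_hasCompactSupport hfsupp.mul_right
  have hi1 : Integrable fun t => deriv (deriv w) t * φ t :=
    (hw2.mul hφ).continuous.integrable_of_hasCompactSupport hwsupp.deriv.deriv.mul_right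
  have hi2 : Integrable fun t => w t * deriv (deriv φ) t :=
    (hw.mul (contDiff_infty_iff_deriv.mp
      (contDiff_infty_iff_deriv.mp hφ).2).2).continuous.integrable_of_hasCompactSupport
      hwsupp.mul_right
  calc ∫ t, (f t - (deriv (deriv w) t + (m : ℂ) ^ 2 * w t)) * φ t
      = ∫ t, (f t * φ t - (deriv (deriv w) t * φ t - w t * deriv (deriv φ) t)) := by
        congr 1
        funext t
        linear_combination (-w t) * hφeq t
    _ = ∫ t, f t * φ t := by
        rw [integral_sub hi0 (by exact hi1.sub hi2), integral_sub hi1 hi2,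
          integral_deriv_deriv_mul hw hwsupp hφ, sub_self, sub_zero]
end

section
/- Let m > 0, let f, g be test functions, and set u := G^R f. Let c ≤ d be real numbers and let χ : ℝ → ℝ be a smooth function with χ(t) = 1 for all t ≤ c, χ(t) = 0 for all t ≥ d, and χ(t) = 1 for every t in the support of g. Then ∫_ℝ ( f(t) − ((χ·u)''(t) + m²·(χ·u)(t)) ) · (G^D g)(t) dt = (1/2)·∫_ℝ f(t)·(G^C g)(t) dt. (The explicit computation showing that the factorization product of the future-translated observable O_{f−P(χ G^R f)} with O_g, built from the Dirac propagator, reproduces the star-product pairing built from the causal propagator, up to an exact term; this underlies the comparison of algebra structures.) -/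
open MeasureTheory

/-- The advanced propagator `(G^A f)(t) = (1/m) ∫_t^∞ sin(m (s - t)) f(s) ds`. -/
noncomputable def advancedProp (m : ℝ) (f : ℝ → ℂ) (t : ℝ) : ℂ :=
  (1 / (m : ℂ)) * ∫ s in Set.Ici t, Complex.sin (((m * (s - t) : ℝ) : ℂ)) * f s

/-- The Dirac propagator `G^D f = (1/2)(G^R f + G^A f)`. -/
noncomputable def diracProp (m : ℝ) (f : ℝ → ℂ) (t : ℝ) : ℂ :=
  (1 / 2 : ℂ) * (retardedProp m f t + advancedProp m f t)

/-- The one-dimensional Klein-Gordon operator `P = d²/dt² + m²`. -/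
noncomputable def kleinGordon (m : ℝ) (u : ℝ → ℂ) (t : ℝ) : ℂ :=
  deriv (deriv u) t + (m : ℂ) ^ 2 * u t

theorem ContDiff.deriv_of_two {u : ℝ → ℂ} (hu : ContDiff ℝ 2 u) : ContDiff ℝ 1 (deriv u) :=
  ((contDiff_succ_iff_deriv (n := 1)).1 hu).2.2

theorem continuous_kleinGordon {m : ℝ} {u : ℝ → ℂ} (hu : ContDiff ℝ 2 u) :
    Continuous (kleinGordon m u) :=
  (hu.deriv_of_two.continuous_deriv le_rfl).add (continuous_const.mul hu.continuous)

theorem deriv_eq_zero_of_isOpen {u : ℝ → ℂ} {s : Set ℝ} (hs : IsOpen s)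
    (hu : ∀ t ∈ s, u t = 0) : ∀ t ∈ s, deriv u t = 0 := fun t ht => by
  have h : u =ᶠ[nhds t] fun _ => 0 := Filter.eventually_of_mem (hs.mem_nhds ht) hu
  rw [h.deriv_eq, deriv_const]

theorem kleinGordon_eq_zero_of_isOpen {m : ℝ} {u : ℝ → ℂ} {s : Set ℝ} (hs : IsOpen s)
    (hu : ∀ t ∈ s, u t = 0) : ∀ t ∈ s, kleinGordon m u t = 0 := fun t ht => by
  rw [kleinGordon, deriv_eq_zero_of_isOpen hs (deriv_eq_zero_of_isOpen hs hu) t ht, hu t ht,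
    mul_zero, add_zero]

theorem integrable_of_eq_zero_outside {w : ℝ → ℂ} {a b : ℝ} (hw : Continuous w)
    (ha : ∀ t < a, w t = 0) (hb : ∀ t > b, w t = 0) : Integrable w :=
  hw.integrable_of_hasCompactSupport <|
    HasCompactSupport.intro (isCompact_Icc (a := a) (b := b)) fun t ht => by
      by_cases h : t < a
      · exact ha t h
      · exact hb t (not_le.1 fun h' => ht ⟨not_lt.1 h, h'⟩)

/-- Green's identity for the Klein-Gordon operator: `P` is symmetric on pairs of functions
supported towards the future and towards the past, respectively. -/
theorem integral_mul_kleinGordon {m : ℝ} {u v : ℝ → ℂ} {a b : ℝ}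
    (hu : ContDiff ℝ 2 u) (hv : ContDiff ℝ 2 v)
    (hua : ∀ t < a, u t = 0) (hvb : ∀ t > b, v t = 0) :
    ∫ t, u t * kleinGordon m v t = ∫ t, kleinGordon m u t * v t := by
  have hua' : ∀ t < a, deriv u t = 0 := deriv_eq_zero_of_isOpen isOpen_Iio hua
  have hvb' : ∀ t > b, deriv v t = 0 := deriv_eq_zero_of_isOpen isOpen_Ioi hvb
  have hPu : ∀ t < a, kleinGordon m u t = 0 := kleinGordon_eq_zero_of_isOpen isOpen_Iio hua
  have hPv : ∀ t > b, kleinGordon m v t = 0 := kleinGordon_eq_zero_of_isOpen isOpen_Ioi hvb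
  have hi₁ : Integrable fun t => u t * kleinGordon m v t :=
    integrable_of_eq_zero_outside (a := a) (b := b)
      (hu.continuous.mul (continuous_kleinGordon hv))
      (fun t ht => by simp [hua t ht]) (fun t ht => by simp [hPv t ht])
  have hi₂ : Integrable fun t => kleinGordon m u t * v t :=
    integrable_of_eq_zero_outside (a := a) (b := b)
      ((continuous_kleinGordon hu).mul hv.continuous)
      (fun t ht => by simp [hPu t ht]) (fun t ht => by simp [hvb t ht])
  have hiW : Integrable fun t => u t * deriv v t - deriv u t * v t :=
    integrable_of_eq_zero_outside (a := a) (b := b)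
      ((hu.continuous.mul hv.deriv_of_two.continuous).sub (hu.deriv_of_two.continuous.mul hv.continuous))
      (fun t ht => by simp [hua t ht, hua' t ht]) (fun t ht => by simp [hvb t ht, hvb' t ht])
  have hW : ∀ t, HasDerivAt (fun t => u t * deriv v t - deriv u t * v t)
      (u t * kleinGordon m v t - kleinGordon m u t * v t) t := fun t => by
    have h1 := (hu.differentiable two_ne_zero t).hasDerivAt
    have h2 := (hv.differentiable two_ne_zero t).hasDerivAt
    have h3 := (hu.deriv_of_two.differentiable one_ne_zero t).hasDerivAt
    have h4 := (hv.deriv_of_two.differentiable one_ne_zero t).hasDerivAt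
    exact ((h1.mul h4).sub (h3.mul h2)).congr_deriv (by rw [kleinGordon, kleinGordon]; ring)
  have h := integral_eq_zero_of_hasDerivAt_of_integrable hW (hi₁.sub hi₂) hiW
  rw [integral_sub hi₁ hi₂] at h
  exact sub_eq_zero.1 h

theorem hasDerivAt_integral_Iic {w : ℝ → ℂ} (hw : Continuous w) (hi : Integrable w) (t : ℝ) :
    HasDerivAt (fun t => ∫ s in Set.Iic t, w s) (w t) t := by
  have h : (fun t => ∫ s in Set.Iic t, w s) =
      fun t => (∫ s in Set.Iic 0, w s) + ∫ s in (0 : ℝ)..t, w s := by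
    funext t
    rw [← intervalIntegral.integral_Iic_sub_Iic hi.integrableOn hi.integrableOn]
    ring
  rw [h]
  exact (hw.integral_hasStrictDerivAt 0 t).hasDerivAt.const_add _

theorem contDiff_two_and_kleinGordon_eq {m : ℝ} {u u' p : ℝ → ℂ} (hp : Continuous p)
    (hu : ∀ t, HasDerivAt u (u' t) t)
    (hu' : ∀ t, HasDerivAt u' (p t - (m : ℂ) ^ 2 * u t) t) :
    ContDiff ℝ 2 u ∧ kleinGordon m u = p := by
  have e : deriv u = u' := funext fun t => (hu t).deriv
  have e' : deriv u' = fun t => p t - (m : ℂ) ^ 2 * u t := funext fun t => (hu' t).deriv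
  have hc : Continuous u := continuous_iff_continuousAt.2 fun t => (hu t).continuousAt
  constructor
  · refine (contDiff_succ_iff_deriv (n := 1)).2 ⟨fun t => (hu t).differentiableAt, by simp, ?_⟩
    rw [e, contDiff_one_iff_deriv, e']
    exact ⟨fun t => (hu' t).differentiableAt, hp.sub (continuous_const.mul hc)⟩
  · funext t
    simp [kleinGordon, e, e']

theorem integral_sin_mul_sub {m : ℝ} {f : ℝ → ℂ} (hf : Continuous f) (hs : HasCompactSupport f)
    (t : ℝ) (S : Set ℝ) :
    ∫ s in S, Complex.sin (((m * (t - s) : ℝ) : ℂ)) * f s =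
      Complex.sin ((m : ℂ) * t) * (∫ s in S, Complex.cos ((m : ℂ) * s) * f s) -
        Complex.cos ((m : ℂ) * t) * ∫ s in S, Complex.sin ((m : ℂ) * s) * f s := by
  have hc : Integrable fun s : ℝ => Complex.cos ((m : ℂ) * s) * f s :=
    Continuous.integrable_of_hasCompactSupport (by fun_prop) hs.mul_left
  have hn : Integrable fun s : ℝ => Complex.sin ((m : ℂ) * s) * f s :=
    Continuous.integrable_of_hasCompactSupport (by fun_prop) hs.mul_left
  rw [← integral_const_mul, ← integral_const_mul,
    ← integral_sub (hc.integrableOn.const_mul _) (hn.integrableOn.const_mul _)]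
  congr 1
  funext s
  push_cast
  rw [mul_sub, Complex.sin_sub]
  ring

theorem hasDerivAt_sin_ofReal_mul (m t : ℝ) :
    HasDerivAt (fun t : ℝ => Complex.sin ((m : ℂ) * t)) (m * Complex.cos ((m : ℂ) * t)) t := by
  simpa [mul_comm] using (((hasDerivAt_id (t : ℂ)).const_mul (m : ℂ)).csin).comp_ofReal

theorem hasDerivAt_cos_ofReal_mul (m t : ℝ) :
    HasDerivAt (fun t : ℝ => Complex.cos ((m : ℂ) * t)) (-(m * Complex.sin ((m : ℂ) * t))) t := by
  simpa [mul_comm] using (((hasDerivAt_id (t : ℂ)).const_mul (m : ℂ)).ccos).comp_ofReal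

/-- Variation of constants for the Klein-Gordon operator. -/
theorem variation_of_constants {m : ℝ} (hm : m ≠ 0) {u A B p : ℝ → ℂ} (hp : Continuous p)
    (hA : ∀ t : ℝ, HasDerivAt A (Complex.cos ((m : ℂ) * t) * p t) t)
    (hB : ∀ t : ℝ, HasDerivAt B (Complex.sin ((m : ℂ) * t) * p t) t)
    (hu : ∀ t : ℝ, u t = 1 / (m : ℂ) *
      (Complex.sin ((m : ℂ) * t) * A t - Complex.cos ((m : ℂ) * t) * B t)) :
    ContDiff ℝ 2 u ∧ kleinGordon m u = p := by
  have hm' : (m : ℂ) ≠ 0 := by exact_mod_cast hm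
  have hS := hasDerivAt_sin_ofReal_mul m
  have hC := hasDerivAt_cos_ofReal_mul m
  refine contDiff_two_and_kleinGordon_eq
    (u' := fun t => Complex.cos ((m : ℂ) * t) * A t + Complex.sin ((m : ℂ) * t) * B t) hp
    (fun t => ?_) fun t => ?_
  · rw [funext hu]
    refine ((((hS t).mul (hA t)).sub ((hC t).mul (hB t))).const_mul (1 / (m : ℂ))).congr_deriv ?_
    field_simp
    ring
  · refine (((hC t).mul (hA t)).add ((hS t).mul (hB t))).congr_deriv ?_
    rw [hu t]
    field_simp
    linear_combination p t * Complex.sin_sq_add_cos_sq ((m : ℂ) * t)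

theorem retardedProp_spec {m : ℝ} (hm : m ≠ 0) {f : ℝ → ℂ} (hf : Continuous f)
    (hs : HasCompactSupport f) :
    ContDiff ℝ 2 (retardedProp m f) ∧ kleinGordon m (retardedProp m f) = f :=
  variation_of_constants hm hf
    (fun t => hasDerivAt_integral_Iic (w := fun s : ℝ => Complex.cos ((m : ℂ) * s) * f s)
      (by fun_prop) (Continuous.integrable_of_hasCompactSupport (by fun_prop) hs.mul_left) t)
    (fun t => hasDerivAt_integral_Iic (w := fun s : ℝ => Complex.sin ((m : ℂ) * s) * f s)
      (by fun_prop) (Continuous.integrable_of_hasCompactSupport (by fun_prop) hs.mul_left) t)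
    (fun t => by rw [retardedProp, integral_sin_mul_sub hf hs])

theorem causalProp_spec {m : ℝ} (hm : m ≠ 0) {f : ℝ → ℂ} (hf : Continuous f)
    (hs : HasCompactSupport f) :
    ContDiff ℝ 2 (causalProp m f) ∧ kleinGordon m (causalProp m f) = fun _ => 0 :=
  variation_of_constants hm continuous_const
    (A := fun _ => ∫ s : ℝ in Set.univ, Complex.cos ((m : ℂ) * s) * f s)
    (B := fun _ => ∫ s : ℝ in Set.univ, Complex.sin ((m : ℂ) * s) * f s)
    (fun t => by simpa using hasDerivAt_const t _)
    (fun t => by simpa using hasDerivAt_const t _)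
    (fun t => by rw [causalProp, ← setIntegral_univ, integral_sin_mul_sub hf hs])

theorem causalProp_eq_retardedProp_sub_advancedProp {m : ℝ} {f : ℝ → ℂ} (hf : Continuous f)
    (hs : HasCompactSupport f) (t : ℝ) :
    causalProp m f t = retardedProp m f t - advancedProp m f t := by
  have hi : Integrable fun s : ℝ => Complex.sin (((m * (t - s) : ℝ) : ℂ)) * f s :=
    Continuous.integrable_of_hasCompactSupport (by fun_prop) hs.mul_left
  have e : (fun s : ℝ => Complex.sin (((m * (s - t) : ℝ) : ℂ)) * f s) =
      fun s : ℝ => -(Complex.sin (((m * (t - s) : ℝ) : ℂ)) * f s) := by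
    funext s
    rw [← neg_sub t s, mul_neg, Complex.ofReal_neg, Complex.sin_neg, neg_mul]
  rw [causalProp, retardedProp, advancedProp, e, integral_neg,
    ← intervalIntegral.integral_Iic_add_Ioi (b := t) hi.integrableOn hi.integrableOn,
    integral_Ici_eq_integral_Ioi]
  ring

theorem advancedProp_spec {m : ℝ} (hm : m ≠ 0) {f : ℝ → ℂ} (hf : Continuous f)
    (hs : HasCompactSupport f) :
    ContDiff ℝ 2 (advancedProp m f) ∧ kleinGordon m (advancedProp m f) = f := by
  obtain ⟨hr, hPr⟩ := retardedProp_spec hm hf hs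
  obtain ⟨hc, hPc⟩ := causalProp_spec hm hf hs
  have e : advancedProp m f = fun t => retardedProp m f t - causalProp m f t := by
    funext t
    rw [causalProp_eq_retardedProp_sub_advancedProp hf hs]
    ring
  refine ⟨e ▸ hr.sub hc, ?_⟩
  have e₁ : deriv (advancedProp m f) =
      fun t => deriv (retardedProp m f) t - deriv (causalProp m f) t := by
    funext t
    rw [e]
    exact deriv_sub (hr.differentiable two_ne_zero t) (hc.differentiable two_ne_zero t)
  have e₂ (t : ℝ) : deriv (deriv (advancedProp m f)) t =
      deriv (deriv (retardedProp m f)) t - deriv (deriv (causalProp m f)) t := by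
    rw [e₁]
    exact deriv_sub (hr.deriv_of_two.differentiable one_ne_zero t) (hc.deriv_of_two.differentiable one_ne_zero t)
  funext t
  have h₁ := congrFun hPr t
  have h₂ := congrFun hPc t
  simp only [kleinGordon] at h₁ h₂ ⊢
  rw [e₂, congrFun e t]
  linear_combination h₁ - h₂

theorem retardedProp_eq_zero {m : ℝ} {f : ℝ → ℂ} {a : ℝ} (ha : ∀ t < a, f t = 0) :
    ∀ t < a, retardedProp m f t = 0 := fun t ht => by
  rw [retardedProp, setIntegral_eq_zero_of_forall_eq_zero, mul_zero]
  intro s hs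
  rw [ha s (lt_of_le_of_lt hs ht), mul_zero]

theorem advancedProp_eq_zero {m : ℝ} {f : ℝ → ℂ} {b : ℝ} (hb : ∀ t > b, f t = 0) :
    ∀ t > b, advancedProp m f t = 0 := fun t ht => by
  rw [advancedProp, setIntegral_eq_zero_of_forall_eq_zero, mul_zero]
  intro s hs
  rw [hb s (lt_of_lt_of_le ht hs), mul_zero]

theorem HasCompactSupport.exists_eq_zero_outside {f : ℝ → ℂ} (hs : HasCompactSupport f) :
    ∃ a b : ℝ, (∀ t < a, f t = 0) ∧ ∀ t > b, f t = 0 := by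
  obtain ⟨a, ha⟩ := hs.isCompact.bddBelow
  obtain ⟨b, hb⟩ := hs.isCompact.bddAbove
  exact ⟨a, b, fun t ht => image_eq_zero_of_notMem_tsupport fun h => (ha h).not_gt ht,
    fun t ht => image_eq_zero_of_notMem_tsupport fun h => (hb h).not_gt ht⟩

/-- The pairing of the future-translated observable
`O_{f - P(χ G^R f)}` against `G^D g` reproduces one half of the causal pairing
`∫ f · G^C g`; this underlies the comparison of the factorization product with
the star product. -/
theorem translated_observable_dirac_pairing (m : ℝ) (hm : 0 < m)
    (f g : ℝ → ℂ) (hf : ContDiff ℝ (⊤ : ℕ∞) f) (hfsupp : HasCompactSupport f)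
    (hg : ContDiff ℝ (⊤ : ℕ∞) g) (hgsupp : HasCompactSupport g)
    (c d : ℝ) (hcd : c ≤ d)
    (χ : ℝ → ℝ) (hχ : ContDiff ℝ (⊤ : ℕ∞) χ)
    (hχ1 : ∀ t : ℝ, t ≤ c → χ t = 1) (hχ0 : ∀ t : ℝ, d ≤ t → χ t = 0)
    (hχg : ∀ t ∈ tsupport g, χ t = 1) :
    letI u : ℝ → ℂ := retardedProp m f
    (∫ t : ℝ,
        (f t - (deriv (deriv (fun s : ℝ => (χ s : ℂ) * u s)) t
                  + (m : ℂ) ^ 2 * ((χ t : ℂ) * u t))) * diracProp m g t)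
      = (1 / 2 : ℂ) * ∫ t : ℝ, f t * causalProp m g t := by
  set u := retardedProp m f
  obtain ⟨a, -, hfa, -⟩ := hfsupp.exists_eq_zero_outside
  obtain ⟨a', b', hga, hgb⟩ := hgsupp.exists_eq_zero_outside
  obtain ⟨hu, hPu⟩ := retardedProp_spec hm.ne' hf.continuous hfsupp
  obtain ⟨hr, hPr⟩ := retardedProp_spec hm.ne' hg.continuous hgsupp
  obtain ⟨hs, hPs⟩ := advancedProp_spec hm.ne' hg.continuous hgsupp
  have hua : ∀ t < a, u t = 0 := retardedProp_eq_zero hfa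
  have hra : ∀ t < a', retardedProp m g t = 0 := retardedProp_eq_zero hga
  have hsb : ∀ t > b', advancedProp m g t = 0 := advancedProp_eq_zero hgb
  set h : ℝ → ℂ := fun s => (χ s : ℂ) * u s with h_def
  have hh : ContDiff ℝ 2 h :=
    (Complex.ofRealCLM.contDiff.comp (contDiff_infty.1 hχ 2)).mul hu
  have hha : ∀ t < a, h t = 0 := fun t ht => by simp [h_def, hua t ht]
  have hhd : ∀ t > d, h t = 0 := fun t ht => by simp [h_def, hχ0 t ht.le]
  have hhg (t : ℝ) : h t * g t = u t * g t := by
    by_cases ht : t ∈ tsupport g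
    · simp [h_def, hχg t ht]
    · simp [image_eq_zero_of_notMem_tsupport ht]
  have hPh : HasCompactSupport (kleinGordon m h) :=
    HasCompactSupport.intro (isCompact_Icc (a := a) (b := d)) fun t ht => by
      by_cases hta : t < a
      · exact kleinGordon_eq_zero_of_isOpen isOpen_Iio hha t hta
      · exact kleinGordon_eq_zero_of_isOpen isOpen_Ioi hhd t
          (not_le.1 fun h' => ht ⟨not_lt.1 hta, h'⟩)
  have int_mul {p v : ℝ → ℂ} (hp : Continuous p) (hps : HasCompactSupport p)
      (hv : ContDiff ℝ 2 v) : Integrable fun t => p t * v t :=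
    (hp.mul hv.continuous).integrable_of_hasCompactSupport hps.mul_right
  have ifr := int_mul hf.continuous hfsupp hr
  have ifs := int_mul hf.continuous hfsupp hs
  have ihr := int_mul (continuous_kleinGordon hh) hPh hr
  have ihs := int_mul (continuous_kleinGordon hh) hPh hs
  have if_add : Integrable fun t => f t * retardedProp m g t + f t * advancedProp m g t :=
    ifr.add ifs
  have ih_add : Integrable fun t =>
      kleinGordon m h t * retardedProp m g t + kleinGordon m h t * advancedProp m g t :=
    ihr.add ihs
  have E₁ : ∫ t, u t * g t = ∫ t, f t * advancedProp m g t := by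
    simpa only [hPs, hPu] using integral_mul_kleinGordon (m := m) hu hs hua hsb
  have E₂ : ∫ t, u t * g t = ∫ t, kleinGordon m h t * advancedProp m g t := by
    simpa only [hPs, hhg] using integral_mul_kleinGordon (m := m) hh hs hha hsb
  have E₃ : ∫ t, u t * g t = ∫ t, kleinGordon m h t * retardedProp m g t := by
    have := integral_mul_kleinGordon (m := m) hr hh hra hhd
    simp only [hPr, mul_comm _ (kleinGordon m h _), mul_comm (g _), hhg] at this
    exact this.symm
  have L : ∀ t, (f t - (deriv (deriv h) t + (m : ℂ) ^ 2 * ((χ t : ℂ) * u t))) * diracProp m g t =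
      (1 / 2 : ℂ) * ((f t * retardedProp m g t + f t * advancedProp m g t) -
        (kleinGordon m h t * retardedProp m g t + kleinGordon m h t * advancedProp m g t)) := by
    intro t
    simp only [diracProp, kleinGordon, h_def]
    ring
  have R : ∀ t, f t * causalProp m g t =
      f t * retardedProp m g t - f t * advancedProp m g t := by
    intro t
    rw [causalProp_eq_retardedProp_sub_advancedProp hg.continuous hgsupp, mul_sub]
  simp only [L, R]
  rw [integral_const_mul, integral_sub if_add ih_add, integral_add ifr ifs,
    integral_add ihr ihs, integral_sub ifr ifs, ← E₁, ← E₂, ← E₃]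
  ring
end

section
/- Fix n ∈ ℕ, a complex number ħ, and a matrix C : Fin n → Fin n → ℂ. Then the exponential product ⋆_C on the polynomial ring ℂ[X₀, …, X_{n−1}] is associative: (F ⋆_C G) ⋆_C H = F ⋆_C (G ⋆_C H) for all polynomials F, G, H. -/
open MvPolynomial

/-- The iterated partial derivative `∂_{i 0} ⋯ ∂_{i (k-1)} F` of a multivariate
polynomial (the order is immaterial since partial derivatives commute). -/
noncomputable def pderivMulti {n k : ℕ} (i : Fin k → Fin n)
    (F : MvPolynomial (Fin n) ℂ) : MvPolynomial (Fin n) ℂ :=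
  (List.ofFn i).foldl (fun p r => MvPolynomial.pderiv r p) F

/-- The exponential product `F ⋆_C G` on `ℂ[X₀, …, X_{n-1}]` determined by a
propagator matrix `C` and formal parameter `hbar`:
`F ⋆_C G = Σ_k (hbarᵏ/k!) Σ_{i,j : Fin k → Fin n} (Π_a C (i a) (j a)) ·
(∂_{i} F) · (∂_{j} G)`.  The sum over `k` has finitely many nonzero terms since
sufficiently high derivatives of a polynomial vanish. -/
noncomputable def expProd {n : ℕ} (hbar : ℂ) (C : Fin n → Fin n → ℂ)
    (F G : MvPolynomial (Fin n) ℂ) : MvPolynomial (Fin n) ℂ :=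
  ∑ᶠ k : ℕ, (hbar ^ k / (k.factorial : ℂ)) •
    ∑ i : Fin k → Fin n, ∑ j : Fin k → Fin n,
      (∏ a : Fin k, C (i a) (j a)) • (pderivMulti i F * pderivMulti j G)

theorem pderivMulti_cons {n k : ℕ} (r : Fin n) (i : Fin k → Fin n)
    (F : MvPolynomial (Fin n) ℂ) :
    pderivMulti (Fin.cons r i : Fin (k + 1) → Fin n) F = pderivMulti i (pderiv r F) := by
  simp [pderivMulti, List.ofFn_succ]

theorem pderiv_comm {n : ℕ} (r s : Fin n) (F : MvPolynomial (Fin n) ℂ) :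
    pderiv r (pderiv s F) = pderiv s (pderiv r F) := by
  have h : ⁅pderiv (R := ℂ) r, pderiv (R := ℂ) s⁆ = 0 := by
    refine MvPolynomial.derivation_ext fun i => ?_
    simp [Derivation.commutator_apply, pderiv_X, Pi.single_apply, apply_ite]
  have := congrArg (fun D => D F) h
  simpa [Derivation.commutator_apply, sub_eq_zero] using this

/-- The `k`-th power of the bidifferential operator `Σ C r s ∂_r ⊗ ∂_s`, followed by
multiplication. -/
noncomputable def bidiffPow {n : ℕ} (C : Fin n → Fin n → ℂ) : ℕ →
    MvPolynomial (Fin n) ℂ →ₗ[ℂ] MvPolynomial (Fin n) ℂ →ₗ[ℂ] MvPolynomial (Fin n) ℂ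
  | 0 => LinearMap.mul ℂ _
  | k + 1 => ∑ r, ∑ s, C r s •
      (bidiffPow C k).compl₁₂ (pderiv r).toLinearMap (pderiv s).toLinearMap

section

variable {n : ℕ} (hbar : ℂ) (C : Fin n → Fin n → ℂ)

theorem bidiffPow_zero (F G : MvPolynomial (Fin n) ℂ) : bidiffPow C 0 F G = F * G := rfl

theorem bidiffPow_succ (k : ℕ) (F G : MvPolynomial (Fin n) ℂ) :
    bidiffPow C (k + 1) F G = ∑ r, ∑ s, C r s • bidiffPow C k (pderiv r F) (pderiv s G) := by
  simp [bidiffPow, LinearMap.sum_apply]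

theorem sum_pderivMulti_eq_bidiffPow (k : ℕ) (F G : MvPolynomial (Fin n) ℂ) :
    ∑ i : Fin k → Fin n, ∑ j : Fin k → Fin n,
      (∏ a : Fin k, C (i a) (j a)) • (pderivMulti i F * pderivMulti j G) =
    bidiffPow C k F G := by
  induction k generalizing F G with
  | zero => simp [pderivMulti, bidiffPow_zero]
  | succ k ih =>
    rw [bidiffPow_succ, ← (Fin.consEquiv fun _ => Fin n).sum_comp, Fintype.sum_prod_type]
    refine Finset.sum_congr rfl fun r _ => ?_
    simp_rw [← (Fin.consEquiv fun _ : Fin (k + 1) => Fin n).sum_comp, Fintype.sum_prod_type]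
    rw [Finset.sum_comm]
    refine Finset.sum_congr rfl fun s _ => ?_
    simp [← ih, Fin.consEquiv, pderivMulti_cons, Fin.prod_univ_succ, Finset.smul_sum, mul_smul]

theorem expProd_eq_finsum (F G : MvPolynomial (Fin n) ℂ) :
    expProd hbar C F G = ∑ᶠ k : ℕ, (hbar ^ k / (k.factorial : ℂ)) • bidiffPow C k F G := by
  simp only [expProd, sum_pderivMulti_eq_bidiffPow]

theorem pderiv_bidiffPow (k : ℕ) (t : Fin n) (F G : MvPolynomial (Fin n) ℂ) :
    pderiv t (bidiffPow C k F G) =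
      bidiffPow C k (pderiv t F) G + bidiffPow C k F (pderiv t G) := by
  induction k generalizing F G with
  | zero => simp only [bidiffPow_zero, Derivation.leibniz, smul_eq_mul]; ring
  | succ k ih =>
    simp only [bidiffPow_succ, map_sum, Derivation.map_smul, ih, smul_add,
      Finset.sum_add_distrib, pderiv_comm t]

theorem bidiffPow_succ_X_mul (k : ℕ) (t : Fin n) (F G : MvPolynomial (Fin n) ℂ) :
    bidiffPow C (k + 1) (X t * F) G = X t * bidiffPow C (k + 1) F G +
      (k + 1 : ℂ) • ∑ s, C t s • bidiffPow C k F (pderiv s G) := by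
  have expand (k : ℕ) (F G : MvPolynomial (Fin n) ℂ) : bidiffPow C (k + 1) (X t * F) G =
      ∑ r, ∑ s, C r s • bidiffPow C k (X t * pderiv r F) (pderiv s G) +
        ∑ s, C t s • bidiffPow C k F (pderiv s G) := by
    simp only [bidiffPow_succ, Derivation.leibniz, pderiv_X, smul_eq_mul, map_add,
      LinearMap.add_apply, smul_add, Finset.sum_add_distrib]
    congr 1
    rw [Finset.sum_eq_single t]
    · simp
    · intro r _ hr
      simp [hr.symm]
    · simp
  induction k generalizing F G with
  | zero =>
    rw [expand]
    simp [bidiffPow_succ, bidiffPow_zero, Finset.mul_sum, mul_assoc]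
  | succ k ih =>
    have swap : ∑ r, ∑ s, C r s • ∑ u, C t u •
        bidiffPow C k (pderiv r F) (pderiv u (pderiv s G)) =
        ∑ u, C t u • bidiffPow C (k + 1) F (pderiv u G) := by
      simp only [bidiffPow_succ, Finset.smul_sum]
      rw [Finset.sum_comm_cycle]
      refine Finset.sum_congr rfl fun u _ => Finset.sum_congr rfl fun r _ =>
        Finset.sum_congr rfl fun s _ => ?_
      rw [smul_comm, pderiv_comm u s]
    rw [expand]
    simp only [ih, smul_add, Finset.sum_add_distrib]
    simp only [smul_comm (C _ _) (k + 1 : ℂ), ← Finset.smul_sum, swap]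
    rw [bidiffPow_succ C (k + 1) F G]
    simp only [Finset.mul_sum, mul_smul_comm]
    push_cast
    module

theorem exists_bidiffPow_eq_zero (F : MvPolynomial (Fin n) ℂ) :
    ∃ N, ∀ k, N ≤ k → ∀ G, bidiffPow C k F G = 0 := by
  induction F using MvPolynomial.induction_on with
  | C a =>
    refine ⟨1, fun k hk G => ?_⟩
    obtain ⟨k, rfl⟩ := Nat.exists_eq_add_of_le' hk
    simp [bidiffPow_succ]
  | add p q hp hq =>
    obtain ⟨N, hN⟩ := hp
    obtain ⟨M, hM⟩ := hq
    refine ⟨max N M, fun k hk G => ?_⟩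
    simp [hN k (le_of_max_le_left hk), hM k (le_of_max_le_right hk)]
  | mul_X p t hp =>
    obtain ⟨N, hN⟩ := hp
    refine ⟨N + 1, fun k hk G => ?_⟩
    obtain ⟨k, rfl⟩ := Nat.exists_eq_add_of_le' (show 1 ≤ k by omega)
    rw [mul_comm, bidiffPow_succ_X_mul]
    simp [hN k (by omega), hN (k + 1) (by omega)]

theorem hasFiniteSupport_bidiffPow (F G : MvPolynomial (Fin n) ℂ) :
    (Function.support fun k : ℕ =>
      (hbar ^ k / (k.factorial : ℂ)) • bidiffPow C k F G).Finite := by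
  obtain ⟨N, hN⟩ := exists_bidiffPow_eq_zero C F
  refine (Set.finite_lt_nat N).subset fun k hk => ?_
  by_contra h
  exact hk (by simp [hN k (not_lt.mp h)])

theorem exists_expProd_eq_sum_range (F : MvPolynomial (Fin n) ℂ) :
    ∃ N, ∀ M, N ≤ M → ∀ G, expProd hbar C F G =
      ∑ k ∈ Finset.range M, (hbar ^ k / (k.factorial : ℂ)) • bidiffPow C k F G := by
  obtain ⟨N, hN⟩ := exists_bidiffPow_eq_zero C F
  refine ⟨N, fun M hM G => ?_⟩
  rw [expProd_eq_finsum]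
  refine finsum_eq_sum_of_support_subset _ fun k hk => ?_
  by_contra h
  exact hk (by simp [hN k (hM.trans (by simpa using h))])

theorem expProd_C_left (a : ℂ) (G : MvPolynomial (Fin n) ℂ) :
    expProd hbar C (MvPolynomial.C a) G = MvPolynomial.C a * G := by
  rw [expProd_eq_finsum, finsum_eq_single _ 0]
  · simp [bidiffPow_zero]
  · intro k hk
    obtain ⟨k, rfl⟩ := Nat.exists_eq_succ_of_ne_zero hk
    simp [bidiffPow_succ]

theorem expProd_add_left (F F' G : MvPolynomial (Fin n) ℂ) :
    expProd hbar C (F + F') G = expProd hbar C F G + expProd hbar C F' G := by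
  simp only [expProd_eq_finsum, map_add, LinearMap.add_apply, smul_add]
  exact finsum_add_distrib (hasFiniteSupport_bidiffPow hbar C F G)
    (hasFiniteSupport_bidiffPow hbar C F' G)

theorem expProd_add_right (F G G' : MvPolynomial (Fin n) ℂ) :
    expProd hbar C F (G + G') = expProd hbar C F G + expProd hbar C F G' := by
  simp only [expProd_eq_finsum, map_add, smul_add]
  exact finsum_add_distrib (hasFiniteSupport_bidiffPow hbar C F G)
    (hasFiniteSupport_bidiffPow hbar C F G')

theorem expProd_smul_left (a : ℂ) (F G : MvPolynomial (Fin n) ℂ) :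
    expProd hbar C (a • F) G = a • expProd hbar C F G := by
  simp only [expProd_eq_finsum, map_smul, LinearMap.smul_apply, smul_finsum]
  simp only [smul_comm a]

theorem expProd_sum_left {ι : Type*} (S : Finset ι) (f : ι → MvPolynomial (Fin n) ℂ)
    (G : MvPolynomial (Fin n) ℂ) :
    expProd hbar C (∑ s ∈ S, f s) G = ∑ s ∈ S, expProd hbar C (f s) G :=
  map_sum (AddMonoidHom.mk' (fun F => expProd hbar C F G)
    fun F F' => expProd_add_left hbar C F F' G) f S

theorem pderiv_expProd (t : Fin n) (F G : MvPolynomial (Fin n) ℂ) :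
    pderiv t (expProd hbar C F G) =
      expProd hbar C (pderiv t F) G + expProd hbar C F (pderiv t G) := by
  obtain ⟨N, hN⟩ := exists_expProd_eq_sum_range hbar C F
  obtain ⟨M, hM⟩ := exists_expProd_eq_sum_range hbar C (pderiv t F)
  have hN := hN (max N M) (le_max_left _ _)
  rw [hN, hN, hM _ (le_max_right N M)]
  simp only [map_sum, Derivation.map_smul, pderiv_bidiffPow, smul_add, Finset.sum_add_distrib]

theorem expProd_X_mul (t : Fin n) (F G : MvPolynomial (Fin n) ℂ) :
    expProd hbar C (X t * F) G = X t * expProd hbar C F G +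
      hbar • ∑ s, C t s • expProd hbar C F (pderiv s G) := by
  obtain ⟨N, hN⟩ := exists_expProd_eq_sum_range hbar C F
  obtain ⟨M, hM⟩ := exists_expProd_eq_sum_range hbar C (X t * F)
  have hK := hN (max N M) (le_max_left _ _)
  rw [hN (max N M + 1) (by omega), hM (max N M + 1) (by omega)]
  simp only [hK]
  rw [Finset.sum_range_succ', Finset.sum_range_succ']
  have coeff (k : ℕ) : hbar ^ (k + 1) / ((k + 1).factorial : ℂ) * (k + 1 : ℂ) =
      hbar * (hbar ^ k / (k.factorial : ℂ)) := by
    have : (k + 1 : ℂ) ≠ 0 := by exact_mod_cast k.succ_ne_zero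
    rw [Nat.factorial_succ]
    push_cast
    field_simp
    ring
  simp only [bidiffPow_succ_X_mul, smul_add, smul_smul, coeff, Finset.sum_add_distrib,
    mul_add, Finset.mul_sum, mul_smul_comm, bidiffPow_zero, mul_assoc]
  rw [add_right_comm]
  congr 1
  simp only [mul_smul, ← Finset.smul_sum]
  simp only [Finset.smul_sum]
  rw [Finset.sum_comm]
  simp only [smul_comm (C t _)]

end

/-- The exponential product `⋆_C` is associative. -/
theorem expProd_assoc {n : ℕ} (hbar : ℂ) (C : Fin n → Fin n → ℂ)
    (F G H : MvPolynomial (Fin n) ℂ) :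
    expProd hbar C (expProd hbar C F G) H = expProd hbar C F (expProd hbar C G H) := by
  induction F using MvPolynomial.induction_on generalizing G H with
  | C a =>
    simp only [expProd_C_left, ← MvPolynomial.smul_eq_C_mul, expProd_smul_left]
  | add p q hp hq => simp only [expProd_add_left, hp, hq]
  | mul_X p t hp =>
    simp only [mul_comm p, expProd_X_mul, expProd_add_left, expProd_smul_left, expProd_sum_left,
      pderiv_expProd, expProd_add_right, hp, smul_add, Finset.sum_add_distrib]
    abel
end

section
/- Fix n ∈ ℕ, a complex number ħ, and a matrix C : Fin n → Fin n → ℂ. For linear polynomials F = Σ_i a_i·X_i and G = Σ_j b_j·X_j (with a, b : Fin n → ℂ), the ⋆_C-commutator is F ⋆_C G − G ⋆_C F = ħ · Σ_{i,j} (C i j − C j i) · a_i · b_j (a constant polynomial). In particular, on linear observables the commutator of the exponential product equals ħ times the pairing given by the antisymmetric part of the propagator, which is the quantization condition [F, G]_⋆ = iħ·{F, G} for the Peierls bracket. -/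
open MvPolynomial

theorem pderivMulti_zero {n k : ℕ} (i : Fin k → Fin n) :
    pderivMulti i (0 : MvPolynomial (Fin n) ℂ) = 0 := by
  induction k with
  | zero => simp [pderivMulti]
  | succ k ih => simpa [pderivMulti, List.ofFn_succ] using ih fun a => i a.succ

theorem pderivMulti_succ {n k : ℕ} (i : Fin (k + 1) → Fin n) (F : MvPolynomial (Fin n) ℂ) :
    pderivMulti i F = pderivMulti (fun a => i a.succ) (pderiv (i 0) F) := by
  simp [pderivMulti, List.ofFn_succ]

theorem pderivMulti_one {n : ℕ} (i : Fin 1 → Fin n) (F : MvPolynomial (Fin n) ℂ) :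
    pderivMulti i F = pderiv (i 0) F := by
  simp [pderivMulti]

theorem pderiv_linear {n : ℕ} (a : Fin n → ℂ) (r : Fin n) :
    pderiv r (∑ i, C (a i) * X i) = C (a r) := by
  simp [map_sum, pderiv_X, Pi.single_apply]

theorem pderivMulti_linear_of_two_le {n k : ℕ} (hk : 2 ≤ k) (i : Fin k → Fin n)
    (a : Fin n → ℂ) : pderivMulti i (∑ i, C (a i) * X i) = 0 := by
  obtain ⟨k, rfl⟩ := Nat.exists_eq_add_of_le' hk
  rw [pderivMulti_succ, pderivMulti_succ, pderiv_linear, pderiv_C, pderivMulti_zero]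

/-- The exponential product of two linear polynomials stops at first order in `ħ`. -/
theorem expProd_linear {n : ℕ} (hbar : ℂ) (P : Fin n → Fin n → ℂ) (a b : Fin n → ℂ) :
    expProd hbar P (∑ i, C (a i) * X i) (∑ j, C (b j) * X j) =
      (∑ i, C (a i) * X i) * (∑ j, C (b j) * X j) +
        C (hbar * ∑ i, ∑ j, P i j * a i * b j) := by
  rw [expProd, finsum_eq_sum_of_support_subset (s := Finset.range 2)]
  · rw [Finset.sum_range_succ, Finset.sum_range_one]
    congr 1
    · simp [pderivMulti]
    · rw [← (Equiv.funUnique (Fin 1) (Fin n)).symm.sum_comp]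
      simp_rw [← (Equiv.funUnique (Fin 1) (Fin n)).symm.sum_comp
        (fun j : Fin 1 → Fin n => (_ : MvPolynomial (Fin n) ℂ))]
      simp only [pderivMulti_one, pderiv_linear]
      simp [smul_eq_C_mul, mul_assoc]
  · intro k hk
    by_contra h
    refine hk ?_
    have h2 : 2 ≤ k := by simpa [Nat.succ_le_iff] using h
    simp [pderivMulti_linear_of_two_le h2]

/-- On linear observables `F = Σ aᵢ Xᵢ`, `G = Σ bⱼ Xⱼ`, the
`⋆_C`-commutator equals `ħ` times the pairing given by the antisymmetric part
of the propagator: `[F, G]_⋆ = ħ Σ_{i,j} (C i j - C j i) aᵢ bⱼ`. -/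
theorem expProd_commutator_linear {n : ℕ} (hbar : ℂ)
    (C : Fin n → Fin n → ℂ) (a b : Fin n → ℂ) :
    letI F : MvPolynomial (Fin n) ℂ :=
      ∑ i : Fin n, MvPolynomial.C (a i) * MvPolynomial.X i
    letI G : MvPolynomial (Fin n) ℂ :=
      ∑ j : Fin n, MvPolynomial.C (b j) * MvPolynomial.X j
    expProd hbar C F G - expProd hbar C G F
      = MvPolynomial.C (hbar * ∑ i : Fin n, ∑ j : Fin n,
          (C i j - C j i) * a i * b j) := by
  have h : ∑ i, ∑ j, C i j * b i * a j = ∑ i, ∑ j, C j i * a i * b j := by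
    rw [Finset.sum_comm]
    exact Finset.sum_congr rfl fun i _ => Finset.sum_congr rfl fun j _ => mul_right_comm _ _ _
  rw [expProd_linear, expProd_linear, mul_comm (∑ j, MvPolynomial.C (b j) * X j),
    add_sub_add_left_eq_sub, ← map_sub, ← mul_sub, h]
  simp only [sub_mul, Finset.sum_sub_distrib]
end

section
/- Fix n ∈ ℕ, a complex number ħ, matrices C, K : Fin n → Fin n → ℂ with K symmetric (K i j = K j i), and subsets S, T ⊆ Fin n. Suppose K i j = C i j for all i ∈ S, j ∈ T, and K i j = C j i for all i ∈ T, j ∈ S. Then for every polynomial F all of whose variables lie in S (i.e. ∂_i F = 0 for i ∉ S) and every polynomial G all of whose variables lie in T, one has F ⋆_K G = G ⋆_K F = F ⋆_C G. (This models the statement that the time-ordered product, built from the symmetric Feynman/Dirac-type kernel, is commutative and agrees with the suitably time-ordered star product for observables with disjoint supports.) -/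
open MvPolynomial

/-- Partial derivatives of multivariate polynomials commute. -/
theorem pderiv_comm_apply {σ R : Type*} [CommRing R] (i j : σ) (p : MvPolynomial σ R) :
    pderiv i (pderiv j p) = pderiv j (pderiv i p) := by
  classical
  have h : ⁅pderiv (R := R) i, pderiv (R := R) j⁆ = 0 := by
    refine MvPolynomial.derivation_ext fun k => ?_
    simp [Derivation.commutator_apply, pderiv_X, Pi.single_apply, apply_ite]
  have hp := congrArg (fun D => D p) h
  simpa [Derivation.commutator_apply, sub_eq_zero] using hp

theorem foldl_pderiv_zero {σ R : Type*} [CommSemiring R] (l : List σ) :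
    l.foldl (fun (p : MvPolynomial σ R) r => pderiv r p) 0 = 0 := by
  induction l with
  | nil => rfl
  | cons r l ih => simpa using ih

/-- An iterated partial derivative vanishes as soon as one of its directions kills the
polynomial. -/
theorem foldl_pderiv_eq_zero {σ R : Type*} [CommRing R] {l : List σ} {i : σ} (hi : i ∈ l)
    {p : MvPolynomial σ R} (hp : pderiv i p = 0) :
    l.foldl (fun (p : MvPolynomial σ R) r => pderiv r p) p = 0 := by
  induction l generalizing p with
  | nil => simp at hi
  | cons r l ih =>
    rw [List.foldl_cons]
    rcases List.mem_cons.mp hi with rfl | hi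
    · rw [hp, foldl_pderiv_zero]
    · exact ih hi (by rw [pderiv_comm_apply, hp, map_zero])

theorem pderivMulti_eq_zero {n k : ℕ} {i : Fin k → Fin n} (a : Fin k)
    {F : MvPolynomial (Fin n) ℂ} (hF : pderiv (i a) F = 0) : pderivMulti i F = 0 :=
  foldl_pderiv_eq_zero (List.mem_ofFn.mpr ⟨a, rfl⟩) hF

/-- The exponential product of a symmetric propagator is commutative. -/
theorem expProd_comm {n : ℕ} (hbar : ℂ) {K : Fin n → Fin n → ℂ}
    (hK : ∀ i j, K i j = K j i) (F G : MvPolynomial (Fin n) ℂ) :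
    expProd hbar K F G = expProd hbar K G F := by
  refine finsum_congr fun k => ?_
  rw [Finset.sum_comm]
  refine congrArg _ (Finset.sum_congr rfl fun j _ => Finset.sum_congr rfl fun i _ => ?_)
  rw [mul_comm, Finset.prod_congr rfl fun a _ => hK (i a) (j a)]

/-- The exponential product depends only on the values of the propagator between the variables
of the two factors. -/
theorem expProd_congr {n : ℕ} (hbar : ℂ) {C K : Fin n → Fin n → ℂ} {S T : Set (Fin n)}
    (h : ∀ i ∈ S, ∀ j ∈ T, K i j = C i j) {F G : MvPolynomial (Fin n) ℂ}
    (hF : ∀ i, i ∉ S → pderiv i F = 0) (hG : ∀ j, j ∉ T → pderiv j G = 0) :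
    expProd hbar K F G = expProd hbar C F G := by
  refine finsum_congr fun k => congrArg _
    (Finset.sum_congr rfl fun i _ => Finset.sum_congr rfl fun j _ => ?_)
  by_cases hi : ∀ a, i a ∈ S
  · by_cases hj : ∀ a, j a ∈ T
    · rw [Finset.prod_congr rfl fun a _ => h (i a) (hi a) (j a) (hj a)]
    · obtain ⟨a, ha⟩ := not_forall.mp hj
      simp [pderivMulti_eq_zero a (hG _ ha)]
  · obtain ⟨a, ha⟩ := not_forall.mp hi
    simp [pderivMulti_eq_zero a (hF _ ha)]

/-- If `K` is a symmetric kernel that agrees with the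
time-ordered rearrangement of `C` between the regions `S` and `T`, then for
observables `F` (with variables in `S`) and `G` (with variables in `T`), the
product `⋆_K` is commutative and agrees with `⋆_C`:
the time-ordered product agrees with the time-ordered star product for
observables with disjoint supports. -/
theorem expProd_timeOrdered_eq_star {n : ℕ} (hbar : ℂ)
    (C K : Fin n → Fin n → ℂ) (hKsymm : ∀ i j, K i j = K j i)
    (S T : Set (Fin n))
    (hST : ∀ i ∈ S, ∀ j ∈ T, K i j = C i j)
    (hTS : ∀ i ∈ T, ∀ j ∈ S, K i j = C j i)
    (F G : MvPolynomial (Fin n) ℂ)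
    (hF : ∀ i : Fin n, i ∉ S → MvPolynomial.pderiv i F = 0)
    (hG : ∀ j : Fin n, j ∉ T → MvPolynomial.pderiv j G = 0) :
    expProd hbar K F G = expProd hbar K G F ∧
    expProd hbar K F G = expProd hbar C F G := by
  exact ⟨expProd_comm hbar hKsymm F G, expProd_congr hbar hST hF hG⟩
end
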